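/- Let X be a finite set with |X| = n. A diversity (X, δ) is embeddable isometrically into the ℓ₁ diversity on ℝ^m for some m if and only if δ is a non-negative linear combination of cut diversities δ_U, U ⊆ X; moreover m can be taken at most C(n, ⌊n/2⌋). -/

import Mathlib

open Finset

structure Diversity (X : Type*) [DecidableEq X] where
  δ : Finset X → ℝ
  nonneg : ∀ A : Finset X, 0 ≤ δ A
  eq_zero_of_card_le_one : ∀ A : Finset X, A.card ≤ 1 → δ A = 0
  triangle : ∀ A B C : Finset X, B.Nonempty → δ (A ∪ C) ≤ δ (A ∪ B) + δ (B ∪ C)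

/-- The ℓ₁ diversity on `ℝ^m`. -/
noncomputable def l1Div {m : ℕ} (A : Finset (Fin m → ℝ)) : ℝ :=
  ∑ i : Fin m,
    if h : A.Nonempty then (A ×ˢ A).sup' (h.product h) (fun p => |p.1 i - p.2 i|) else 0

/-- The cut diversity `δ_U`: 1 if `A` meets both `U` and its complement, else 0. -/
def cutDiv {X : Type*} [DecidableEq X] (U A : Finset X) : ℝ :=
  if (A ∩ U).Nonempty ∧ (A \ U).Nonempty then 1 else 0


open MeasureTheory in
lemma level_aux {X : Type*} [Fintype X] [DecidableEq X] (f : X → ℝ) :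
    ∃ lam : Finset X → ℝ, (∀ U, 0 ≤ lam U) ∧ ∀ A : Finset X, A.Nonempty →
      ∃ a ∈ A, ∃ b ∈ A, f a - f b = ∑ U : Finset X, lam U * cutDiv U A ∧
        ∀ x ∈ A, f b ≤ f x ∧ f x ≤ f a := by
  classical
  let L : ℝ → Finset X := fun t => univ.filter (fun x => t < f x)
  have hmeas : ∀ U, MeasurableSet {t | L t = U} := by
    intro U
    have : {t | L t = U} = ⋂ x : X, (if x ∈ U then Set.Iio (f x) else Set.Ici (f x)) := by
      ext t
      simp only [Set.mem_ofPred_eq, Set.mem_iInter, L, Finset.ext_iff, Finset.mem_filter,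
        Finset.mem_univ, true_and]
      refine forall_congr' fun x => ?_
      by_cases hx : x ∈ U <;> simp [hx]
    rw [this]
    refine MeasurableSet.iInter fun x => ?_
    split_ifs
    · exact measurableSet_Iio
    · exact measurableSet_Ici
  refine ⟨fun U => (volume {t | L t = U}).toReal, fun U => ENNReal.toReal_nonneg, ?_⟩
  intro A hA
  obtain ⟨a, ha, hamax⟩ := A.exists_max_image f hA
  obtain ⟨b, hb, hbmin⟩ := A.exists_min_image f hA
  refine ⟨a, ha, b, hb, ?_, fun x hx => ⟨hbmin x hx, hamax x hx⟩⟩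
  let S : Finset (Finset X) := univ.filter (fun U => (A ∩ U).Nonempty ∧ (A \ U).Nonempty)
  have hU : (⋃ U ∈ S, {t | L t = U}) = Set.Ico (f b) (f a) := by
    ext t
    simp only [S, L, Set.mem_iUnion, Finset.mem_filter, Finset.mem_univ, true_and,
      Set.mem_ofPred_eq, exists_prop, exists_eq_right', Set.mem_Ico]
    constructor
    · rintro ⟨⟨x, hx⟩, ⟨y, hy⟩⟩
      simp at hx hy
      exact ⟨(hbmin y hy.1).trans hy.2, hx.2.trans_le (hamax x hx.1)⟩
    · rintro ⟨h1, h2⟩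
      exact ⟨⟨a, by simp [ha, h2]⟩, ⟨b, by simp [hb, h1]⟩⟩
  have hle : f b ≤ f a := hbmin a ha
  have key : volume (⋃ U ∈ S, {t | L t = U}) = ∑ U ∈ S, volume {t | L t = U} := by
    refine measure_biUnion_finset ?_ (fun U _ => hmeas U)
    intro U _ V _ hUV
    refine Set.disjoint_left.2 fun t h1 h2 => hUV ?_
    have h1' : L t = U := h1
    have h2' : L t = V := h2
    exact h1'.symm.trans h2'
  rw [hU, Real.volume_Ico] at key
  have hfin : ∀ U ∈ S, volume {t | L t = U} ≠ ⊤ := by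
    intro U hUS
    have : ∑ U ∈ S, volume {t | L t = U} ≠ ⊤ := by rw [← key]; exact ENNReal.ofReal_ne_top
    exact (ENNReal.sum_ne_top.1 this) U hUS
  have k2 := congrArg ENNReal.toReal key
  rw [ENNReal.toReal_sum hfin, ENNReal.toReal_ofReal (by linarith)] at k2
  rw [k2, Finset.sum_filter]
  refine Finset.sum_congr rfl fun U _ => ?_
  unfold cutDiv
  split_ifs <;> simp

lemma l1_aux {X : Type*} [Fintype X] [DecidableEq X] {m : ℕ} (φ : X → Fin m → ℝ)
    (g : Fin m → ℝ) (A : Finset X) (h0 : A = ∅ → ∀ i, g i = 0)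
    (h1 : ∀ i, ∀ a ∈ A, ∀ b ∈ A, φ a i - φ b i ≤ g i)
    (h2 : A.Nonempty → ∀ i, ∃ a ∈ A, ∃ b ∈ A, φ a i - φ b i = g i) :
    l1Div (A.image φ) = ∑ i, g i := by
  unfold l1Div
  refine Finset.sum_congr rfl fun i _ => ?_
  split_ifs with h
  · have hA : A.Nonempty := by simpa using h
    apply le_antisymm
    · apply Finset.sup'_le
      rintro ⟨p, q⟩ hpq
      simp only [Finset.mem_product, Finset.mem_image] at hpq
      obtain ⟨⟨a, ha, rfl⟩, ⟨b, hb, rfl⟩⟩ := hpq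
      rw [abs_le]
      have := h1 i a ha b hb
      have := h1 i b hb a ha
      constructor <;> simp <;> linarith
    · obtain ⟨a, ha, b, hb, hab⟩ := h2 hA i
      rw [← hab]
      refine (le_abs_self _).trans ?_
      have hmem : (φ a, φ b) ∈ A.image φ ×ˢ A.image φ :=
        Finset.mem_product.2 ⟨Finset.mem_image_of_mem _ ha, Finset.mem_image_of_mem _ hb⟩
      have := Finset.le_sup' (fun p : (Fin m → ℝ) × (Fin m → ℝ) => |p.1 i - p.2 i|) hmem
      exact this
  · exact (h0 (by simpa using h) i).symm

lemma scd_aux {X : Type*} [DecidableEq X] (s : Finset X) :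
    ∃ (ι : Type) (_ : Fintype ι) (r : ι → ℕ) (C : ι → ℕ → Finset X),
      (∀ i, 2 * r i ≤ #s) ∧
      (∀ i k, r i ≤ k → k + r i ≤ #s → C i k ⊆ s ∧ #(C i k) = k) ∧
      (∀ i k l, r i ≤ k → k ≤ l → l + r i ≤ #s → C i k ⊆ C i l) ∧
      (∀ U ⊆ s, ∃ i, r i ≤ #U ∧ #U + r i ≤ #s ∧ C i #U = U) ∧
      (∀ i j k, r i ≤ k → k + r i ≤ #s → r j ≤ k → k + r j ≤ #s → C i k = C j k → i = j) := by
  induction s using Finset.induction_on with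
  | empty =>
    refine ⟨Unit, inferInstance, fun _ => 0, fun _ _ => ∅, ?_, ?_, ?_, ?_, ?_⟩
    · simp
    · intro i k _ h; simp at h; simp [h]
    · simp
    · intro U hU; simp at hU; simp [hU]
    · simp
  | insert a s ha ih =>
    obtain ⟨ι, hι, r, C, h1, h2, h3, h4, h5⟩ := ih
    have hn : #(insert a s) = #s + 1 := Finset.card_insert_of_notMem ha
    rw [hn]
    have hnot : ∀ i k, r i ≤ k → k + r i ≤ #s → a ∉ C i k :=
      fun i k hk hk' h => ha ((h2 i k hk hk').1 h)
    have hins : ∀ i j k, r i ≤ k → k + r i ≤ #s → r j ≤ k → k + r j ≤ #s →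
        insert a (C i k) = insert a (C j k) → i = j := by
      intro i j k a1 a2 a3 a4 h
      apply h5 i j k a1 a2 a3 a4
      have := congrArg (fun T => T.erase a) h
      simpa [Finset.erase_insert (hnot i k a1 a2), Finset.erase_insert (hnot j k a3 a4)] using this
    refine ⟨ι ⊕ {i // 2 * r i < #s}, Fintype.ofFinite _, Sum.elim r (fun i => r i.1 + 1),
      Sum.elim (fun i k => if k + r i ≤ #s then C i k else insert a (C i (k - 1)))
        (fun i k => insert a (C i.1 (k - 1))), ?_, ?_, ?_, ?_, ?_⟩
    · rintro (i | ⟨i, hi⟩)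
      · have := h1 i; simp; omega
      · simp; omega
    · rintro (i | ⟨i, hi⟩) k hk hk' <;> simp only [Sum.elim_inl, Sum.elim_inr] at hk hk' ⊢
      · have := h1 i
        split_ifs with h
        · exact ⟨(h2 i k hk h).1.trans (Finset.subset_insert _ _), (h2 i k hk h).2⟩
        · have := h2 i (k-1) (by omega) (by omega)
          refine ⟨Finset.insert_subset_insert _ this.1, ?_⟩
          rw [Finset.card_insert_of_notMem (hnot i (k-1) (by omega) (by omega)), this.2]
          omega
      · have := h2 i (k-1) (by omega) (by omega)
        refine ⟨Finset.insert_subset_insert _ this.1, ?_⟩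
        rw [Finset.card_insert_of_notMem (hnot i (k-1) (by omega) (by omega)), this.2]
        omega
    · rintro (i | ⟨i, hi⟩) k l hk hkl hl <;> simp only [Sum.elim_inl, Sum.elim_inr] at hk hl ⊢
      · have := h1 i
        split_ifs with b1 b2 b2
        · exact h3 i k l hk hkl b2
        · exact (h3 i k (l-1) hk (by omega) (by omega)).trans (Finset.subset_insert _ _)
        · omega
        · exact Finset.insert_subset_insert _ (h3 i (k-1) (l-1) (by omega) (by omega) (by omega))
      · exact Finset.insert_subset_insert _ (h3 i (k-1) (l-1) (by omega) (by omega) (by omega))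
    · intro U hU
      by_cases haU : a ∈ U
      · obtain ⟨i, i1, i2, i3⟩ := h4 (U.erase a) (Finset.subset_insert_iff.1 hU)
        have hc := Finset.card_erase_of_mem haU
        have hpos : 0 < #U := Finset.card_pos.2 ⟨a, haU⟩
        rw [hc] at i1 i2 i3
        have hh := h1 i
        by_cases htop : #U + r i ≤ #s
        · refine ⟨Sum.inr ⟨i, by omega⟩, ?_, ?_, ?_⟩ <;> simp only [Sum.elim_inr]
          · omega
          · omega
          · rw [i3, Finset.insert_erase haU]
        · refine ⟨Sum.inl i, ?_, ?_, ?_⟩ <;> simp only [Sum.elim_inl]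
          · omega
          · omega
          · rw [if_neg htop, i3, Finset.insert_erase haU]
      · obtain ⟨i, i1, i2, i3⟩ := h4 U ((Finset.subset_insert_iff_of_notMem haU).1 hU)
        exact ⟨Sum.inl i, i1, by simp; omega, by simp [i2, i3]⟩
    · rintro (i | ⟨i, hi⟩) (j | ⟨j, hj⟩) k e1 e2 e3 e4 h <;>
        simp only [Sum.elim_inl, Sum.elim_inr] at e1 e2 e3 e4 h
      · have := h1 i
        have := h1 j
        congr 1
        split_ifs at h with b1 b2 b2
        · exact h5 i j k e1 b1 e3 b2 h
        · exact absurd (h ▸ Finset.mem_insert_self a _) (hnot i k e1 b1)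
        · exact absurd (h ▸ Finset.mem_insert_self a _) (hnot j k e3 b2)
        · exact hins i j (k-1) (by omega) (by omega) (by omega) (by omega) h
      · exfalso
        have := h1 i
        split_ifs at h with b1
        · exact absurd (h ▸ Finset.mem_insert_self a _) (hnot i k e1 b1)
        · have := hins i j (k-1) (by omega) (by omega) (by omega) (by omega) h
          subst this
          omega
      · exfalso
        have := h1 j
        split_ifs at h with b1
        · exact absurd (h ▸ Finset.mem_insert_self a _) (hnot j k e3 b1)
        · have := hins i j (k-1) (by omega) (by omega) (by omega) (by omega) h
          subst this
          omega
      · have := hins i j (k-1) (by omega) (by omega) (by omega) (by omega) h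
        subst this
        rfl

lemma chains_aux (X : Type*) [Fintype X] [DecidableEq X] :
    ∃ m ≤ Nat.choose (Fintype.card X) (Fintype.card X / 2), ∃ c : Finset X → Fin m,
      ∀ U V, c U = c V → U ⊆ V ∨ V ⊆ U := by
  obtain ⟨ι, hι, r, C, h1, h2, h3, h4, h5⟩ := scd_aux (univ : Finset X)
  rw [Finset.card_univ] at *
  set n := Fintype.card X with hn
  choose c hc1 hc2 hc3 using fun U : Finset X => h4 U (Finset.subset_univ _)
  refine ⟨Fintype.card ι, ?_, fun U => Fintype.equivFin ι (c U), ?_⟩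
  · rw [hn, ← Finset.card_univ (α := X), ← Finset.card_powersetCard, ← Finset.card_univ]
    refine Finset.card_le_card_of_injOn (fun i => C i (n / 2)) ?_ ?_
    · intro i _
      have := h1 i
      rw [Finset.mem_coe, Finset.mem_powersetCard]
      exact ⟨Finset.subset_univ _, (h2 i (n/2) (by omega) (by omega)).2⟩
    · intro i _ j _ h
      have := h1 i
      have := h1 j
      exact h5 i j (n/2) (by omega) (by omega) (by omega) (by omega) h
  · intro U V h
    have h := (Fintype.equivFin ι).injective h
    rcases le_total #U #V with hl | hl
    · left
      have := h3 (c V) #U #V (h ▸ hc1 U) hl (hc2 V)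
      rwa [hc3 V, ← h, hc3 U] at this
    · right
      have := h3 (c U) #V #U (h ▸ hc1 V) hl (hc2 U)
      rwa [hc3 U, h, hc3 V] at this

lemma embed_aux {X : Type*} [Fintype X] [DecidableEq X] (lam : Finset X → ℝ)
    (hlam : ∀ U, 0 ≤ lam U) {m : ℕ} (c : Finset X → Fin m)
    (hc : ∀ U V, c U = c V → U ⊆ V ∨ V ⊆ U) :
    ∃ φ : X → Fin m → ℝ, ∀ A : Finset X,
      ∑ U : Finset X, lam U * cutDiv U A = l1Div (A.image φ) := by
  classical
  refine ⟨fun x i => ∑ U with c U = i, if x ∈ U then lam U else 0, fun A => ?_⟩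
  rw [l1_aux _ (fun i => ∑ U with c U = i, lam U * cutDiv U A) A]
  · exact (Finset.sum_fiberwise _ _ _).symm
  · rintro rfl i
    simp [cutDiv]
  · intro i a ha b hb
    rw [← Finset.sum_sub_distrib]
    refine Finset.sum_le_sum fun U _ => ?_
    have := hlam U
    unfold cutDiv
    by_cases h1 : a ∈ U <;> by_cases h2 : b ∈ U
    · simp only [h1, h2]; split_ifs <;> simp [this]
    · rw [if_pos (c := (A ∩ U).Nonempty ∧ (A \ U).Nonempty)
        (⟨⟨a, by simp [*]⟩, ⟨b, by simp [*]⟩⟩)]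
      simp [h1, h2]
    · simp only [h1, h2]; split_ifs <;> simp <;> linarith
    · simp only [h1, h2]; split_ifs <;> simp [this]
  · intro hA i
    let K : X → Finset (Finset X) := fun x => univ.filter fun U => c U = i ∧ x ∈ U
    have hK : ∀ x y, #(K x) ≤ #(K y) → K x ⊆ K y := by
      intro x y h
      by_contra hn
      obtain ⟨U, hU, hU'⟩ := Finset.not_subset.1 hn
      simp only [K, Finset.mem_filter, Finset.mem_univ, true_and, not_and] at hU hU'
      have hlt : K y ⊂ K x := by
        refine (Finset.ssubset_iff_of_subset ?_).2 ⟨U, by simp [K, hU], by simp [K, hU' hU.1]⟩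
        intro V hV
        simp only [K, Finset.mem_filter, Finset.mem_univ, true_and] at hV ⊢
        refine ⟨hV.1, ?_⟩
        rcases hc U V (hU.1.trans hV.1.symm) with h | h
        · exact h hU.2
        · exact absurd (h hV.2) (hU' hU.1)
      exact absurd (Finset.card_lt_card hlt) (by omega)
    obtain ⟨a, ha, hamax⟩ := A.exists_max_image (fun x => #(K x)) hA
    obtain ⟨b, hb, hbmin⟩ := A.exists_min_image (fun x => #(K x)) hA
    refine ⟨a, ha, b, hb, ?_⟩
    rw [← Finset.sum_sub_distrib]
    refine Finset.sum_congr rfl fun U hU => ?_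
    simp only [Finset.mem_filter, Finset.mem_univ, true_and] at hU
    have hx : ∀ x ∈ A, (b ∈ U → x ∈ U) ∧ (x ∈ U → a ∈ U) := by
      intro x hx
      have e1 : U ∈ K b → U ∈ K x := fun h => hK b x (hbmin x hx) h
      have e2 : U ∈ K x → U ∈ K a := fun h => hK x a (hamax x hx) h
      simp only [K, Finset.mem_filter, Finset.mem_univ, true_and, hU] at e1 e2
      exact ⟨e1, e2⟩
    unfold cutDiv
    by_cases h1 : a ∈ U
    · by_cases h2 : b ∈ U
      · rw [if_neg (c := (A ∩ U).Nonempty ∧ (A \ U).Nonempty)]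
        · simp [h1, h2]
        · rintro ⟨_, ⟨y, hy⟩⟩
          rw [Finset.mem_sdiff] at hy
          exact hy.2 ((hx y hy.1).1 h2)
      · rw [if_pos (c := (A ∩ U).Nonempty ∧ (A \ U).Nonempty)
          (⟨⟨a, by simp [*]⟩, ⟨b, by simp [*]⟩⟩)]
        simp [h1, h2]
    · have h2 : b ∉ U := fun h => h1 ((hx a ha).1 h)
      rw [if_neg (c := (A ∩ U).Nonempty ∧ (A \ U).Nonempty)]
      · simp [h1, h2]
      · rintro ⟨⟨y, hy⟩, _⟩
        rw [Finset.mem_inter] at hy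
        exact h1 ((hx y hy.1).2 hy.2)

/-- a diversity on a finite set `X` with `|X| = n` embeds
isometrically into the ℓ₁ diversity on `ℝ^m` for some `m` iff it is a
non-negative combination of cut diversities; moreover `m` can be taken at most
`C(n, ⌊n/2⌋)`. -/
theorem l1_embeddable_iff_split_system {X : Type*} [Fintype X] [DecidableEq X]
    (D : Diversity X) :
    ((∃ (m : ℕ) (φ : X → Fin m → ℝ), ∀ A : Finset X, D.δ A = l1Div (A.image φ)) ↔
      (∃ lam : Finset X → ℝ, (∀ U, 0 ≤ lam U) ∧
        ∀ A : Finset X, D.δ A = ∑ U : Finset X, lam U * cutDiv U A)) ∧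
    ((∃ lam : Finset X → ℝ, (∀ U, 0 ≤ lam U) ∧
        ∀ A : Finset X, D.δ A = ∑ U : Finset X, lam U * cutDiv U A) →
      ∃ m ≤ Nat.choose (Fintype.card X) (Fintype.card X / 2),
        ∃ φ : X → Fin m → ℝ, ∀ A : Finset X, D.δ A = l1Div (A.image φ)) := by
  have main : (∃ lam : Finset X → ℝ, (∀ U, 0 ≤ lam U) ∧
        ∀ A : Finset X, D.δ A = ∑ U : Finset X, lam U * cutDiv U A) →
      ∃ m ≤ Nat.choose (Fintype.card X) (Fintype.card X / 2),
        ∃ φ : X → Fin m → ℝ, ∀ A : Finset X, D.δ A = l1Div (A.image φ) := by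
    rintro ⟨lam, hlam, hD⟩
    obtain ⟨m, hm, c, hc⟩ := chains_aux X
    obtain ⟨φ, hφ⟩ := embed_aux lam hlam c hc
    exact ⟨m, hm, φ, fun A => (hD A).trans (hφ A)⟩
  refine ⟨⟨?_, fun h => ?_⟩, main⟩
  · rintro ⟨m, φ, hφ⟩
    choose lam hlam hl using fun i => level_aux (fun x => φ x i)
    refine ⟨fun U => ∑ i, lam i U, fun U => Finset.sum_nonneg fun i _ => hlam i U, fun A => ?_⟩
    rw [hφ A, l1_aux φ (fun i => ∑ U, lam i U * cutDiv U A) A]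
    · simp_rw [Finset.sum_mul]
      exact Finset.sum_comm
    · rintro rfl i
      simp [cutDiv]
    · intro i a ha b hb
      obtain ⟨p, hp, q, hq, he, hx⟩ := hl i A ⟨a, ha⟩
      have := hx a ha
      have := hx b hb
      linarith
    · intro hA i
      obtain ⟨p, hp, q, hq, he, hx⟩ := hl i A hA
      exact ⟨p, hp, q, hq, he⟩
  · obtain ⟨m, _, φ, hφ⟩ := main h
    exact ⟨m, φ, hφ⟩
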